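/- Fix an integer k ≥ 2. For n > k define P_{n,k} := (n! / ((k−2)!(n−k)!)) ∫₀¹ ∫_u^1 Φ( √2 (2Φ⁻¹(u) − Φ⁻¹(v)) ) (v−u)^{k−2} (1−v)^{n−k} dv du. Then lim_{n→∞} (n² / √(log n)) · P_{n,k} = 24√(2π) / ((k+2)(k+3)). -/

import Mathlib

open Filter Set

/-- The standard normal cumulative distribution function
`Φ(t) = ∫_{-∞}^t e^{-z²/2}/√(2π) dz`. -/
noncomputable def stdNormalCDF (t : ℝ) : ℝ :=
  ∫ z in Set.Iic t, Real.exp (-z ^ 2 / 2) / Real.sqrt (2 * Real.pi)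

/-- The inverse function `Φ⁻¹ : (0,1) → ℝ` of the standard normal CDF. -/
noncomputable def stdNormalCDFInv : ℝ → ℝ :=
  Function.invFun stdNormalCDF


open MeasureTheory ProbabilityTheory Topology

lemma phi_eq_pdf (z : ℝ) :
    Real.exp (-z ^ 2 / 2) / Real.sqrt (2 * Real.pi) = gaussianPDFReal 0 1 z := by
  rw [gaussianPDFReal_def]
  simp
  field_simp

lemma phi_integrable :
    Integrable (fun z : ℝ => Real.exp (-z ^ 2 / 2) / Real.sqrt (2 * Real.pi)) := by
  simp_rw [phi_eq_pdf]
  exact integrable_gaussianPDFReal 0 1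

lemma stdNormalCDF_eq_cdf : stdNormalCDF = fun t => cdf (gaussianReal 0 1) t := by
  funext t
  rw [cdf_eq_real, Measure.real, gaussianReal_apply_eq_integral 0 one_ne_zero, ENNReal.toReal_ofReal]
  · unfold stdNormalCDF
    simp_rw [phi_eq_pdf]
  · exact integral_nonneg fun x => gaussianPDFReal_nonneg _ _ _

lemma stdNormalCDF_hasDerivAt (t : ℝ) :
    HasDerivAt stdNormalCDF (Real.exp (-t ^ 2 / 2) / Real.sqrt (2 * Real.pi)) t := by
  have h : stdNormalCDF = fun t => (∫ z in (0:ℝ)..t,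
      Real.exp (-z ^ 2 / 2) / Real.sqrt (2 * Real.pi)) + stdNormalCDF 0 := by
    funext s
    rw [← intervalIntegral.integral_Iic_sub_Iic phi_integrable.integrableOn
      phi_integrable.integrableOn]
    unfold stdNormalCDF
    ring
  rw [h]
  apply HasDerivAt.add_const
  have hc : Continuous (fun z : ℝ => Real.exp (-z ^ 2 / 2) / Real.sqrt (2 * Real.pi)) := by
    fun_prop
  exact intervalIntegral.integral_hasDerivAt_right (hc.intervalIntegrable _ _)
    (hc.stronglyMeasurableAtFilter _ _) hc.continuousAt

lemma stdNormalCDF_continuous : Continuous stdNormalCDF :=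
  continuous_iff_continuousAt.2 fun t => (stdNormalCDF_hasDerivAt t).continuousAt

lemma stdNormalCDF_strictMono : StrictMono stdNormalCDF := by
  apply strictMono_of_deriv_pos
  intro t
  rw [(stdNormalCDF_hasDerivAt t).deriv]
  positivity

lemma stdNormalCDF_atBot : Tendsto stdNormalCDF atBot (𝓝 0) := by
  rw [stdNormalCDF_eq_cdf]; exact tendsto_cdf_atBot _

lemma stdNormalCDF_atTop : Tendsto stdNormalCDF atTop (𝓝 1) := by
  rw [stdNormalCDF_eq_cdf]; exact tendsto_cdf_atTop _

lemma stdNormalCDF_le_one (t : ℝ) : stdNormalCDF t ≤ 1 := by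
  rw [stdNormalCDF_eq_cdf]; exact cdf_le_one _ _

lemma stdNormalCDF_pos (t : ℝ) : 0 < stdNormalCDF t := by
  have h0 : 0 ≤ stdNormalCDF (t - 1) := by
    rw [stdNormalCDF_eq_cdf]; exact cdf_nonneg _ _
  exact h0.trans_lt (stdNormalCDF_strictMono (by linarith))

lemma stdNormalCDF_inv {u : ℝ} (h0 : 0 < u) (h1 : u < 1) :
    stdNormalCDF (stdNormalCDFInv u) = u := by
  apply Function.invFun_eq
  have := mem_range_of_exists_le_of_exists_ge stdNormalCDF_continuous
    ((stdNormalCDF_atBot.eventually (gt_mem_nhds h0)).exists.imp fun _ h => h.le)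
    ((stdNormalCDF_atTop.eventually (lt_mem_nhds h1)).exists.imp fun _ h => h.le)
  exact this

lemma stdNormalCDFInv_measurable : Measurable stdNormalCDFInv := by
  have he := stdNormalCDF_continuous.measurableEmbedding stdNormalCDF_strictMono.injective
  have : stdNormalCDFInv = Function.extend stdNormalCDF id
      (fun _ => Classical.choice (inferInstance : Nonempty ℝ)) := by
    funext u
    by_cases h : ∃ a, stdNormalCDF a = u
    · obtain ⟨a, rfl⟩ := h
      rw [stdNormalCDF_strictMono.injective.extend_apply]
      exact Function.leftInverse_invFun stdNormalCDF_strictMono.injective a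
    · rw [Function.extend_apply' _ _ _ h]
      exact Function.invFun_neg h
  rw [this]
  exact he.measurable_extend measurable_id measurable_const

/-- Normalised Mills ratio. -/
noncomputable def millsM (t : ℝ) : ℝ :=
  stdNormalCDF (-t) / (Real.exp (-t ^ 2 / 2) / (Real.sqrt (2 * Real.pi) * t))

lemma gauss_exp_tendsto : Tendsto (fun t : ℝ => Real.exp (-t ^ 2 / 2)) atTop (𝓝 0) := by
  apply Real.tendsto_exp_atBot.comp
  have h : Tendsto (fun t : ℝ => t ^ 2 / 2) atTop atTop :=
    (tendsto_pow_atTop two_ne_zero).atTop_div_const (by norm_num)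
  refine (tendsto_neg_atTop_atBot.comp h).congr fun t => ?_
  simp [neg_div]

lemma millsM_tendsto : Tendsto millsM atTop (𝓝 1) := by
  have hs : (0:ℝ) < Real.sqrt (2 * Real.pi) := by positivity
  unfold millsM
  apply HasDerivAt.lhopital_zero_atTop
    (f' := fun t => -(Real.exp (-t ^ 2 / 2) / Real.sqrt (2 * Real.pi)))
    (g' := fun t => -(Real.exp (-t ^ 2 / 2) / Real.sqrt (2 * Real.pi)) * (1 + (t ^ 2)⁻¹))
  · filter_upwards with t
    have := (stdNormalCDF_hasDerivAt (-t)).comp t (hasDerivAt_neg t)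
    convert! this using 1
    simp
  · filter_upwards [eventually_gt_atTop 0] with t ht
    have h1 : HasDerivAt (fun t : ℝ => -t ^ 2 / 2) (-t) t := by
      have := ((hasDerivAt_pow 2 t).neg).div_const 2
      convert! this using 1
      simp; ring
    have h2 := h1.exp.div ((hasDerivAt_id t).const_mul (Real.sqrt (2 * Real.pi)))
      (mul_ne_zero hs.ne' ht.ne')
    convert! h2 using 1
    simp only [id]
    field_simp
    ring
  · filter_upwards [eventually_gt_atTop 0] with t ht
    have : 0 < Real.exp (-t ^ 2 / 2) / Real.sqrt (2 * Real.pi) * (1 + (t ^ 2)⁻¹) := by positivity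
    rw [neg_mul]
    exact (neg_neg_of_pos this).ne
  · exact stdNormalCDF_atBot.comp tendsto_neg_atTop_atBot
  · exact gauss_exp_tendsto.div_atTop (tendsto_id.const_mul_atTop hs)
  · have h : Tendsto (fun t : ℝ => (1 + (t ^ 2)⁻¹)⁻¹) atTop (𝓝 1) := by
      have : Tendsto (fun t : ℝ => (1 + (t ^ 2)⁻¹)⁻¹) atTop (𝓝 ((1 + 0)⁻¹)) :=
        ((tendsto_inv_atTop_zero.comp (tendsto_pow_atTop two_ne_zero)).const_add 1).inv₀ (by norm_num)
      simpa using this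
    refine h.congr' ?_
    filter_upwards [eventually_gt_atTop 0] with t ht
    field_simp

lemma millsM_pos {t : ℝ} (ht : 0 < t) : 0 < millsM t := by
  unfold millsM
  have := stdNormalCDF_pos (-t)
  positivity

lemma cdf_neg_eq {t : ℝ} (ht : 0 < t) :
    stdNormalCDF (-t) = millsM t * Real.exp (-t ^ 2 / 2) / (Real.sqrt (2 * Real.pi) * t) := by
  unfold millsM
  field_simp

lemma exp_eq_cdf {t : ℝ} (ht : 0 < t) :
    Real.exp (-t ^ 2 / 2) = stdNormalCDF (-t) * (Real.sqrt (2 * Real.pi) * t) / millsM t := by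
  have := millsM_pos ht
  rw [cdf_neg_eq ht]
  field_simp

lemma neg_log_cdf_tendsto :
    Tendsto (fun t => -Real.log (stdNormalCDF (-t)) / t ^ 2) atTop (𝓝 (1 / 2)) := by
  have hs : (0:ℝ) < Real.sqrt (2 * Real.pi) := by positivity
  have hsq : Tendsto (fun t : ℝ => t ^ 2) atTop atTop := tendsto_pow_atTop two_ne_zero
  have h1 : Tendsto (fun t => Real.log (millsM t) / t ^ 2) atTop (𝓝 0) :=
    ((Real.continuousAt_log one_ne_zero).tendsto.comp millsM_tendsto).div_atTop hsq
  have h2 : Tendsto (fun t : ℝ => Real.log t / t ^ 2) atTop (𝓝 0) := by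
    have := (isLittleO_log_rpow_atTop (r := 2) (by norm_num)).tendsto_div_nhds_zero
    simpa using this
  have h3 : Tendsto (fun t : ℝ => Real.log (Real.sqrt (2 * Real.pi)) / t ^ 2) atTop (𝓝 0) :=
    tendsto_const_nhds.div_atTop hsq
  have h4 := (((h3.add h2).sub h1).const_add (1/2))
  simp only [add_zero, sub_zero] at h4
  refine h4.congr' ?_
  filter_upwards [eventually_gt_atTop 0] with t ht
  rw [cdf_neg_eq ht, Real.log_div (mul_pos (millsM_pos ht) (Real.exp_pos _)).ne' (by positivity),
    Real.log_mul (millsM_pos ht).ne' (Real.exp_pos _).ne', Real.log_exp,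
    Real.log_mul hs.ne' ht.ne']
  field_simp
  ring

lemma sqrt_two_sq_half (w : ℝ) : -(Real.sqrt 2 * w) ^ 2 / 2 = -w ^ 2 := by
  rw [mul_pow, Real.sq_sqrt (by norm_num)]; ring

lemma alpha_tendsto {x : ℝ} (hx : 0 < x) :
    Tendsto (fun n : ℕ => -stdNormalCDFInv (x / n)) atTop atTop := by
  rw [tendsto_atTop]
  intro b
  have h0 : Tendsto (fun n : ℕ => x / (n : ℝ)) atTop (𝓝 0) :=
    tendsto_const_nhds.div_atTop tendsto_natCast_atTop_atTop
  filter_upwards [h0.eventually (gt_mem_nhds (stdNormalCDF_pos (-b))),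
    h0.eventually (gt_mem_nhds one_pos), eventually_gt_atTop 0] with n h1 h2 h3
  have h3' : (0:ℝ) < n := by exact_mod_cast h3
  rw [← stdNormalCDF_inv (div_pos hx h3') h2] at h1
  have := stdNormalCDF_strictMono.lt_iff_lt.1 h1
  linarith

lemma cdf_alpha_eventually {x : ℝ} (hx : 0 < x) :
    ∀ᶠ n : ℕ in atTop, stdNormalCDF (-(-stdNormalCDFInv (x / n))) = x / n := by
  have h0 : Tendsto (fun n : ℕ => x / (n : ℝ)) atTop (𝓝 0) :=
    tendsto_const_nhds.div_atTop tendsto_natCast_atTop_atTop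
  filter_upwards [h0.eventually (gt_mem_nhds one_pos), eventually_gt_atTop 0] with n h2 h3
  have h3' : (0:ℝ) < n := by exact_mod_cast h3
  rw [neg_neg, stdNormalCDF_inv (div_pos hx h3') h2]

lemma sqrt_log_div_alpha {x : ℝ} (hx : 0 < x) :
    Tendsto (fun n : ℕ => Real.sqrt 2 * Real.sqrt (Real.log n) / -stdNormalCDFInv (x / n))
      atTop (𝓝 1) := by
  have hα := alpha_tendsto hx
  have h1 := neg_log_cdf_tendsto.comp hα
  have h2 : Tendsto (fun n : ℕ => Real.log x / (-stdNormalCDFInv (x / n)) ^ 2) atTop (𝓝 0) :=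
    tendsto_const_nhds.div_atTop ((tendsto_pow_atTop two_ne_zero).comp hα)
  have h3 := ((h1.add h2).const_mul 2).sqrt
  norm_num at h3
  refine h3.congr' ?_
  filter_upwards [cdf_alpha_eventually hx, hα.eventually (eventually_gt_atTop 0),
    eventually_gt_atTop 0] with n h4 h5 h6
  have h6' : (0:ℝ) < n := by exact_mod_cast h6
  rw [neg_neg] at h4
  rw [h4, Real.log_div hx.ne' h6'.ne', ← Real.sqrt_mul (by norm_num)]
  set a := -stdNormalCDFInv (x / n) with ha
  have : stdNormalCDFInv (x / n) ^ 2 = a ^ 2 := by rw [ha]; ring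
  rw [this]
  have e : 2 * (-(Real.log x - Real.log n) / a ^ 2 + Real.log x / a ^ 2)
      = 2 * Real.log n / a ^ 2 := by field_simp; ring
  rw [e, Real.sqrt_div' _ (sq_nonneg a), Real.sqrt_sq h5.le, Real.sqrt_mul (by norm_num)]

lemma alpha_sub_gamma {x y : ℝ} (hx : 0 < x) (hxy : x < y) :
    Tendsto (fun n : ℕ => -stdNormalCDFInv (x / n) - -stdNormalCDFInv (y / n))
      atTop (𝓝 0) := by
  have hy := hx.trans hxy
  have hα := alpha_tendsto hx
  have hγ := alpha_tendsto hy
  have hup : Tendsto (fun n : ℕ => (-2 * Real.log (x / (4 * y))) / -stdNormalCDFInv (y / n))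
      atTop (𝓝 0) := tendsto_const_nhds.div_atTop hγ
  have key : ∀ᶠ n : ℕ in atTop, 0 ≤ -stdNormalCDFInv (x / n) - -stdNormalCDFInv (y / n) ∧
      -stdNormalCDFInv (x / n) - -stdNormalCDFInv (y / n) ≤
        (-2 * Real.log (x / (4 * y))) / -stdNormalCDFInv (y / n) := by
    filter_upwards [cdf_alpha_eventually hx, cdf_alpha_eventually hy,
      hα.eventually (eventually_gt_atTop 0), hγ.eventually (eventually_gt_atTop 0),
      (millsM_tendsto.comp hα).eventually (gt_mem_nhds (show (1:ℝ) < 2 by norm_num)),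
      (millsM_tendsto.comp hγ).eventually (lt_mem_nhds (show (1/2:ℝ) < 1 by norm_num)),
      eventually_gt_atTop 0] with n e1 e2 a0 g0 m1 m2 n0
    have n0' : (0:ℝ) < n := by exact_mod_cast n0
    simp only [Function.comp] at m1 m2
    set a := -stdNormalCDFInv (x / n)
    set g := -stdNormalCDFInv (y / n)
    have hga : g < a := by
      have : stdNormalCDF (-a) < stdNormalCDF (-g) := by
        rw [e1, e2]; gcongr
      have := stdNormalCDF_strictMono.lt_iff_lt.1 this
      linarith
    refine ⟨by linarith, ?_⟩
    have hs : (0:ℝ) < Real.sqrt (2 * Real.pi) := by positivity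
    have Ea := exp_eq_cdf a0
    have Eg := exp_eq_cdf g0
    rw [e1] at Ea
    rw [e2] at Eg
    have ma := millsM_pos a0
    have mg := millsM_pos g0
    have hle : x / (4 * y) ≤ Real.exp (-a ^ 2 / 2 - -g ^ 2 / 2) := by
      rw [Real.exp_sub, Ea, Eg]
      have : x / n * (Real.sqrt (2 * Real.pi) * a) / millsM a /
          (y / n * (Real.sqrt (2 * Real.pi) * g) / millsM g)
          = (x / y) * ((a / g) * (millsM g / millsM a)) := by field_simp
      rw [this]
      have h1 : 1 ≤ a / g := (one_le_div g0).2 hga.le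
      have h2 : 1 / 4 ≤ millsM g / millsM a := by
        rw [div_le_div_iff₀ (by norm_num) ma]; linarith
      have h3 : x / (4 * y) = x / y * (1 * (1 / 4)) := by field_simp
      rw [h3]
      gcongr
    have hlog := Real.log_le_log (by positivity) hle
    rw [Real.log_exp] at hlog
    rw [le_div_iff₀ g0]
    nlinarith
  exact squeeze_zero' (key.mono fun _ h => h.1) (key.mono fun _ h => h.2) hup

lemma pointwise_key {x y : ℝ} (hx : 0 < x) (hxy : x < y) :
    Tendsto (fun n : ℕ => (n : ℝ) ^ 2 / Real.sqrt (Real.log n) *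
      stdNormalCDF (Real.sqrt 2 * (2 * stdNormalCDFInv (x / n) - stdNormalCDFInv (y / n))))
      atTop (𝓝 (Real.sqrt (2 * Real.pi) * (x ^ 4 / y ^ 2))) := by
  have hy := hx.trans hxy
  have hα := alpha_tendsto hx
  have hγ := alpha_tendsto hy
  have hd := alpha_sub_gamma hx hxy
  have hs := sqrt_log_div_alpha hx
  set α : ℕ → ℝ := fun n => -stdNormalCDFInv (x / n) with hαd
  set γ : ℕ → ℝ := fun n => -stdNormalCDFInv (y / n) with hγd
  have hd' : Tendsto (fun n => α n - γ n) atTop (𝓝 0) := hd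
  have hr : Tendsto (fun n => γ n / α n) atTop (𝓝 1) := by
    have := (hd'.div_atTop hα).const_sub 1
    simp only [sub_zero] at this
    refine this.congr' ?_
    filter_upwards [hα.eventually (eventually_gt_atTop 0)] with n h
    field_simp
    ring
  have hwα : Tendsto (fun n => 2 * α n - γ n) atTop atTop := by
    have := hα.atTop_add hd'
    refine this.congr fun n => ?_
    ring
  have hw2 : Tendsto (fun n => Real.sqrt 2 * (2 * α n - γ n)) atTop atTop :=
    hwα.const_mul_atTop (by positivity)
  have M1 := millsM_tendsto.comp hα
  have M2 := millsM_tendsto.comp hγ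
  have M3 := millsM_tendsto.comp hw2
  have hE : Tendsto (fun n => Real.exp (-2 * (α n - γ n) ^ 2)) atTop (𝓝 1) := by
    have : Tendsto (fun n => -2 * (α n - γ n) ^ 2) atTop (𝓝 (-2 * 0 ^ 2)) :=
      (hd'.pow 2).const_mul (-2)
    have := this.rexp
    simpa using this
  have hmain := ((((M3.mul (M2.pow 2)).div (M1.pow 4) (by norm_num)).mul hE).div
    (((hr.pow 2).mul (hr.const_sub 2)).mul hs) (by norm_num)).const_mul
    (Real.sqrt (2 * Real.pi) * (x ^ 4 / y ^ 2))
  norm_num at hmain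
  have h2e : Real.sqrt (2 * Real.pi) = Real.sqrt 2 * Real.sqrt Real.pi := by
    rw [Real.sqrt_mul (by norm_num)]
  rw [← h2e] at hmain
  refine hmain.congr' ?_
  filter_upwards [cdf_alpha_eventually hx, cdf_alpha_eventually hy,
      hα.eventually (eventually_gt_atTop 0), hγ.eventually (eventually_gt_atTop 0),
      hwα.eventually (eventually_gt_atTop 0), eventually_gt_atTop 1] with n e1 e2 a0 g0 w0 n1
  have n0 : (0:ℝ) < n := by exact_mod_cast (zero_lt_one.trans n1)
  have n1' : (1:ℝ) < n := by exact_mod_cast n1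
  have hl : 0 < Real.sqrt (Real.log n) := Real.sqrt_pos.2 (Real.log_pos n1')
  have ea : -(-stdNormalCDFInv (x / n)) = -(α n) := rfl
  have eg : -(-stdNormalCDFInv (y / n)) = -(γ n) := rfl
  rw [ea] at e1
  rw [eg] at e2
  have harg : Real.sqrt 2 * (2 * stdNormalCDFInv (x / n) - stdNormalCDFInv (y / n))
      = -(Real.sqrt 2 * (2 * α n - γ n)) := by simp only [hαd, hγd]; ring
  have hs2 : 0 < Real.sqrt 2 := by positivity
  have eα' : -stdNormalCDFInv (x / n) = α n := rfl
  try rw [eα']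
  rw [harg, cdf_neg_eq (mul_pos hs2 w0), sqrt_two_sq_half]
  have hexp : Real.exp (-(2 * α n - γ n) ^ 2) =
      Real.exp (-(α n) ^ 2 / 2) ^ 4 / Real.exp (-(γ n) ^ 2 / 2) ^ 2 *
        Real.exp (-2 * (α n - γ n) ^ 2) := by
    rw [← Real.exp_nat_mul, ← Real.exp_nat_mul, ← Real.exp_sub, ← Real.exp_add]
    congr 1
    push_cast
    ring
  rw [hexp, exp_eq_cdf a0, exp_eq_cdf g0, e1, e2]
  have m1 := millsM_pos a0
  have m2 := millsM_pos g0
  have m3 := millsM_pos (mul_pos hs2 w0)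
  have hEe : Real.exp (-(2 * (α n - γ n) ^ 2)) = Real.exp (-2 * (α n - γ n) ^ 2) := by
    rw [neg_mul]
  rw [hEe]
  have hsp : 0 < Real.sqrt (2 * Real.pi) := by positivity
  generalize Real.sqrt (2 * Real.pi) = s at *
  generalize Real.exp (-2 * (α n - γ n) ^ 2) = E at *
  generalize millsM (Real.sqrt 2 * (2 * α n - γ n)) = m at *
  generalize millsM (α n) = p at *
  generalize millsM (γ n) = q at *
  generalize Real.sqrt (Real.log n) = l at *
  generalize Real.sqrt 2 = t at *
  generalize α n = a at *
  generalize γ n = g at *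
  have hne : 2 * a - g ≠ 0 := w0.ne'
  have hne2 : 2 - g / a ≠ 0 := by
    have : 2 - g / a = (2 * a - g) / a := by field_simp
    rw [this]; positivity
  have e3 : 2 - g / a = (2 * a - g) / a := by field_simp
  try rw [e3]
  field_simp

lemma cdf_sqrt_two_bound : ∃ C : ℝ, 0 < C ∧ ∀ a : ℝ, stdNormalCDF (Real.sqrt 2 * a) ≤
    C * stdNormalCDF a ^ 2 * (1 + Real.sqrt (-Real.log (stdNormalCDF a))) := by
  have hs2 : 0 < Real.sqrt 2 := by positivity
  have hs : (0:ℝ) < Real.sqrt (2 * Real.pi) := by positivity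
  have hw2 : Tendsto (fun t : ℝ => Real.sqrt 2 * t) atTop atTop :=
    tendsto_id.const_mul_atTop hs2
  have hev := (((millsM_tendsto.comp hw2).eventually (gt_mem_nhds (show (1:ℝ) < 2 by norm_num))).and
    (millsM_tendsto.eventually (lt_mem_nhds (show (1/2:ℝ) < 1 by norm_num)))).and
    (neg_log_cdf_tendsto.eventually (lt_mem_nhds (show (1/4:ℝ) < 1/2 by norm_num)))
  obtain ⟨T, hT⟩ := eventually_atTop.1 (hev.and (eventually_gt_atTop 0))
  have hpT := stdNormalCDF_pos (-T)
  refine ⟨(stdNormalCDF (-T) ^ 2)⁻¹ + 16 * Real.sqrt (2 * Real.pi), by positivity, fun a => ?_⟩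
  have hpa := stdNormalCDF_pos a
  have hsq := Real.sqrt_nonneg (-Real.log (stdNormalCDF a))
  rcases le_total (-T) a with h | h
  · have h1 : stdNormalCDF (-T) ≤ stdNormalCDF a := stdNormalCDF_strictMono.monotone h
    calc stdNormalCDF (Real.sqrt 2 * a) ≤ 1 := stdNormalCDF_le_one _
      _ ≤ (stdNormalCDF (-T) ^ 2)⁻¹ * stdNormalCDF a ^ 2 * (1 + 0) := by
        rw [add_zero, mul_one, inv_mul_eq_div, one_le_div (pow_pos hpT 2)]
        gcongr
      _ ≤ _ := by
        gcongr
        have : 0 < 16 * Real.sqrt (2 * Real.pi) := by positivity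
        linarith
  · obtain ⟨⟨⟨m1, m2⟩, m3⟩, t0⟩ := hT (-a) (by linarith)
    simp only [Function.comp] at m1
    obtain ⟨t, rfl⟩ : ∃ t, a = -t := ⟨-a, by ring⟩
    simp only [neg_neg] at m1 m2 m3 t0
    have hle : t ≤ 2 * Real.sqrt (-Real.log (stdNormalCDF (-t))) := by
      rw [lt_div_iff₀ (by positivity)] at m3
      have : t / 2 ≤ Real.sqrt (-Real.log (stdNormalCDF (-t))) := by
        apply Real.le_sqrt_of_sq_le
        nlinarith
      linarith
    have mt := millsM_pos t0
    have e : stdNormalCDF (Real.sqrt 2 * -t) = millsM (Real.sqrt 2 * t) / millsM t ^ 2 *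
        (Real.sqrt (2 * Real.pi) / Real.sqrt 2) * t * stdNormalCDF (-t) ^ 2 := by
      rw [mul_neg, cdf_neg_eq (mul_pos hs2 t0), sqrt_two_sq_half]
      have : Real.exp (-t ^ 2) = Real.exp (-t ^ 2 / 2) ^ 2 := by
        rw [← Real.exp_nat_mul]; congr 1; push_cast; ring
      rw [this, exp_eq_cdf t0]
      field_simp
    have b1 : millsM (Real.sqrt 2 * t) / millsM t ^ 2 ≤ 8 := by
      rw [div_le_iff₀ (by positivity)]
      nlinarith
    have b2 : Real.sqrt (2 * Real.pi) / Real.sqrt 2 ≤ Real.sqrt (2 * Real.pi) := by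
      apply div_le_self hs.le
      exact Real.one_le_sqrt.2 (by norm_num)
    rw [e]
    have m0 := millsM_pos (mul_pos hs2 t0)
    set Q := Real.sqrt (-Real.log (stdNormalCDF (-t)))
    calc _ ≤ 8 * Real.sqrt (2 * Real.pi) * (2 * Q) * stdNormalCDF (-t) ^ 2 := by gcongr
      _ = (16 * Real.sqrt (2 * Real.pi)) * stdNormalCDF (-t) ^ 2 * Q := by ring
      _ ≤ _ := by
        gcongr
        · have : 0 < (stdNormalCDF (-T) ^ 2)⁻¹ := by positivity
          linarith
        · linarith

lemma dom_bound : ∃ C : ℝ, 0 < C ∧ ∀ (n : ℕ) (x y : ℝ), 3 ≤ n → 0 < x → x < y → y < n →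
    (n : ℝ) ^ 2 / Real.sqrt (Real.log n) *
      stdNormalCDF (Real.sqrt 2 * (2 * stdNormalCDFInv (x / n) - stdNormalCDFInv (y / n)))
      ≤ C * (2 * x ^ 2 + x) := by
  obtain ⟨C, hC, hb⟩ := cdf_sqrt_two_bound
  refine ⟨C, hC, fun n x y hn hx hxy hyn => ?_⟩
  have hn' : (3:ℝ) ≤ n := by exact_mod_cast hn
  have n0 : (0:ℝ) < n := by linarith
  have hlog : 1 ≤ Real.log n := by
    rw [Real.le_log_iff_exp_le n0]
    have := Real.exp_one_lt_d9
    linarith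
  have hy := hx.trans hxy
  have ux : stdNormalCDF (stdNormalCDFInv (x / n)) = x / n :=
    stdNormalCDF_inv (by positivity) ((div_lt_one n0).2 (by linarith))
  have uy : stdNormalCDF (stdNormalCDFInv (y / n)) = y / n :=
    stdNormalCDF_inv (by positivity) ((div_lt_one n0).2 (by linarith))
  have hlt : stdNormalCDFInv (x / n) < stdNormalCDFInv (y / n) := by
    rw [← stdNormalCDF_strictMono.lt_iff_lt, ux, uy]; gcongr
  have h1 : stdNormalCDF (Real.sqrt 2 * (2 * stdNormalCDFInv (x / n) - stdNormalCDFInv (y / n)))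
      ≤ stdNormalCDF (Real.sqrt 2 * stdNormalCDFInv (x / n)) := by
    apply stdNormalCDF_strictMono.monotone
    gcongr
    linarith
  have h2 := hb (stdNormalCDFInv (x / n))
  rw [ux] at h2
  set l := Real.sqrt (Real.log n) with hl
  have l1 : 1 ≤ l := Real.one_le_sqrt.2 hlog
  have hll : l ^ 2 = Real.log n := Real.sq_sqrt (by linarith)
  have h3 : Real.sqrt (-Real.log (x / n)) ≤ l * (1 + 1 / x) := by
    apply Real.sqrt_le_iff.2 ⟨by positivity, ?_⟩
    rw [mul_pow, hll, Real.log_div hx.ne' n0.ne']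
    have h4 : -Real.log x ≤ 1 / x := by
      rw [← Real.log_inv, one_div]
      have := Real.log_le_sub_one_of_pos (inv_pos.2 hx)
      linarith
    have h5 : 0 < 1 / x := by positivity
    nlinarith [mul_nonneg (sub_nonneg.2 hlog) h5.le, mul_pos h5 h5]
  calc _ ≤ (n : ℝ) ^ 2 / l * (C * (x / n) ^ 2 * (l + l * (1 + 1 / x))) := by
        gcongr
        refine (h1.trans h2).trans ?_
        gcongr
    _ = C * (2 * x ^ 2 + x) := by field_simp; ring

noncomputable def fN (m n : ℕ) (p : ℝ × ℝ) : ℝ :=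
  if 0 < p.1 ∧ p.1 < p.2 ∧ p.2 < n then
    (n : ℝ) ^ 2 / Real.sqrt (Real.log n) *
      stdNormalCDF (Real.sqrt 2 * (2 * stdNormalCDFInv (p.1 / n) - stdNormalCDFInv (p.2 / n))) *
      (p.2 - p.1) ^ m * (1 - p.2 / n) ^ (n - (m + 2))
  else 0

noncomputable def gL (m : ℕ) (p : ℝ × ℝ) : ℝ :=
  if 0 < p.1 ∧ p.1 < p.2 then
    Real.sqrt (2 * Real.pi) * (p.1 ^ 4 / p.2 ^ 2) * (p.2 - p.1) ^ m * Real.exp (-p.2)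
  else 0

noncomputable def bd (m : ℕ) (C : ℝ) (p : ℝ × ℝ) : ℝ :=
  (Ioi (0:ℝ)).indicator (fun x => C * (2 * x ^ 2 + x) * Real.exp (-(1/4) * x)) p.1 *
  (Ioi (0:ℝ)).indicator (fun y => y ^ m * Real.exp (-(1/4) * y)) p.2

lemma fN_measurable (m n : ℕ) : Measurable (fN m n) := by
  have h1 := stdNormalCDFInv_measurable
  have h2 := stdNormalCDF_continuous.measurable
  unfold fN
  refine Measurable.ite ?_ (by fun_prop) measurable_const
  exact (measurableSet_lt measurable_const measurable_fst).inter
    ((measurableSet_lt measurable_fst measurable_snd).inter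
      (measurableSet_lt measurable_snd measurable_const))

lemma gL_measurable (m : ℕ) : Measurable (gL m) := by
  unfold gL
  refine Measurable.ite ?_ (by fun_prop) measurable_const
  exact (measurableSet_lt measurable_const measurable_fst).inter
    (measurableSet_lt measurable_fst measurable_snd)

lemma pow_exp_integrableOn (m : ℕ) {b : ℝ} (hb : 0 < b) :
    IntegrableOn (fun x : ℝ => x ^ m * Real.exp (-b * x)) (Ioi 0) := by
  have := integrableOn_rpow_mul_exp_neg_mul_rpow (p := 1) (s := m) (b := b)
    (by have : (0:ℝ) ≤ m := by positivity
        linarith) one_pos hb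
  simpa using this

lemma bd_integrable (m : ℕ) (C : ℝ) : Integrable (bd m C) (volume.prod volume) := by
  unfold bd
  refine Integrable.mul_prod (f := (Ioi (0:ℝ)).indicator _) (g := (Ioi (0:ℝ)).indicator _) ?_ ?_
  · rw [integrable_indicator_iff measurableSet_Ioi]
    have := (((pow_exp_integrableOn 2 (b := 1/4) (by norm_num)).const_mul 2).add
      (pow_exp_integrableOn 1 (b := 1/4) (by norm_num))).const_mul C
    refine this.congr (ae_of_all _ fun x => ?_)
    simp only [Pi.add_apply]
    ring
  · rw [integrable_indicator_iff measurableSet_Ioi]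
    exact pow_exp_integrableOn m (by norm_num)

lemma one_sub_pow_le {n j : ℕ} {y : ℝ} (hn : 2 * j ≤ n) (n0 : 0 < n) (hy : 0 < y) (hyn : y < n) :
    (1 - y / n) ^ (n - j) ≤ Real.exp (-y / 2) := by
  have n0' : (0:ℝ) < n := by exact_mod_cast n0
  have h1 : 0 ≤ 1 - y / n := by
    rw [sub_nonneg, div_le_one n0']; exact hyn.le
  calc (1 - y / n) ^ (n - j) ≤ Real.exp (-(y / n)) ^ (n - j) := by
        gcongr
        exact Real.one_sub_le_exp_neg _
    _ = Real.exp (((n - j : ℕ) : ℝ) * (-(y / n))) := by rw [Real.exp_nat_mul]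
    _ ≤ _ := by
        apply Real.exp_le_exp.2
        have h2 : ((n - j : ℕ) : ℝ) = n - j := Nat.cast_sub (by omega)
        have h3 : (2:ℝ) * j ≤ n := by exact_mod_cast hn
        rw [h2]
        have : ((n:ℝ) - j) * (-(y / n)) = -(((n:ℝ) - j) * y / n) := by ring
        rw [this, neg_div]
        apply neg_le_neg
        rw [div_le_div_iff₀ (by norm_num) n0']
        nlinarith

lemma fN_bound (m : ℕ) : ∃ C : ℝ, ∀ n : ℕ, 3 ≤ n → 2 * (m + 2) ≤ n → ∀ p, ‖fN m n p‖ ≤ bd m C p := by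
  obtain ⟨C, hC, hb⟩ := dom_bound
  refine ⟨C, fun n hn hn2 p => ?_⟩
  obtain ⟨x, y⟩ := p
  unfold fN bd
  dsimp only
  split_ifs with h
  · obtain ⟨hx, hxy, hyn⟩ := h
    have hy := hx.trans hxy
    have n0 : (0:ℝ) < n := by linarith
    have h1 := hb n x y hn hx hxy hyn
    have h2 := one_sub_pow_le hn2 (by omega) hy hyn
    have h3 : 0 ≤ 1 - y / n := by
      rw [sub_nonneg, div_le_one n0]; exact hyn.le
    have h4 := stdNormalCDF_pos (Real.sqrt 2 * (2 * stdNormalCDFInv (x / n) - stdNormalCDFInv (y / n)))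
    have h5 : 0 ≤ y - x := by linarith
    rw [indicator_of_mem (show x ∈ Ioi (0:ℝ) from hx), indicator_of_mem (show y ∈ Ioi (0:ℝ) from hy),
      Real.norm_of_nonneg (by positivity)]
    have h6 : Real.exp (-y / 2) ≤ Real.exp (-(1/4) * x) * Real.exp (-(1/4) * y) := by
      rw [← Real.exp_add]
      apply Real.exp_le_exp.2
      linarith
    calc _ ≤ C * (2 * x ^ 2 + x) * y ^ m * (Real.exp (-(1/4) * x) * Real.exp (-(1/4) * y)) := by
          gcongr
          · linarith
          · exact h2.trans h6
      _ = _ := by ring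
  · rw [norm_zero]
    apply mul_nonneg <;> apply indicator_nonneg <;> intro z hz <;>
    · have : 0 < z := hz
      positivity

lemma one_sub_pow_tendsto (j : ℕ) (y : ℝ) :
    Tendsto (fun n : ℕ => (1 - y / (n:ℝ)) ^ (n - j)) atTop (𝓝 (Real.exp (-y))) := by
  have h0 : Tendsto (fun n : ℕ => 1 - y / (n : ℝ)) atTop (𝓝 1) := by
    have : Tendsto (fun n : ℕ => y / (n : ℝ)) atTop (𝓝 0) :=
      tendsto_const_nhds.div_atTop tendsto_natCast_atTop_atTop
    simpa using this.const_sub 1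
  have h1 := (Real.tendsto_one_add_div_pow_exp (-y)).div (h0.pow j) (by norm_num)
  simp only [one_pow, div_one] at h1
  refine h1.congr' ?_
  filter_upwards [h0.eventually (lt_mem_nhds one_pos), eventually_ge_atTop j] with n hn hj
  have : 1 + -y / (n:ℝ) = 1 - y / n := by ring
  simp only [Pi.div_apply]
  rw [this, pow_sub₀ _ hn.ne' hj, div_eq_mul_inv]

lemma fN_tendsto (m : ℕ) (p : ℝ × ℝ) : Tendsto (fun n => fN m n p) atTop (𝓝 (gL m p)) := by
  obtain ⟨x, y⟩ := p
  unfold fN gL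
  dsimp only
  by_cases h : 0 < x ∧ x < y
  · rw [if_pos h]
    have h1 := ((pointwise_key h.1 h.2).mul_const ((y - x) ^ m)).mul (one_sub_pow_tendsto (m + 2) y)
    refine h1.congr' ?_
    filter_upwards [tendsto_natCast_atTop_atTop.eventually (eventually_gt_atTop y)] with n hn
    rw [if_pos ⟨h.1, h.2, hn⟩]
  · rw [if_neg h]
    refine tendsto_const_nhds.congr fun n => ?_
    rw [if_neg]
    tauto

lemma fN_integrable_eventually (m : ℕ) :
    ∀ᶠ n in atTop, Integrable (fN m n) (volume.prod volume) := by
  obtain ⟨C, hC⟩ := fN_bound m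
  filter_upwards [eventually_ge_atTop 3, eventually_ge_atTop (2 * (m + 2))] with n h1 h2
  exact (bd_integrable m C).mono' (fN_measurable m n).aestronglyMeasurable
    (ae_of_all _ (hC n h1 h2))

lemma gL_integrable (m : ℕ) : Integrable (gL m) (volume.prod volume) := by
  obtain ⟨C, hC⟩ := fN_bound m
  refine (bd_integrable m C).mono' (gL_measurable m).aestronglyMeasurable (ae_of_all _ fun p => ?_)
  refine le_of_tendsto (fN_tendsto m p).norm ?_
  filter_upwards [eventually_ge_atTop 3, eventually_ge_atTop (2 * (m + 2))] with n h1 h2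
  exact hC n h1 h2 p

lemma fN_integral_tendsto (m : ℕ) :
    Tendsto (fun n => ∫ x, ∫ y, fN m n (x, y)) atTop (𝓝 (∫ p, gL m p ∂(volume.prod volume))) := by
  obtain ⟨C, hC⟩ := fN_bound m
  have : Tendsto (fun n => ∫ p, fN m n p ∂(volume.prod volume)) atTop
      (𝓝 (∫ p, gL m p ∂(volume.prod volume))) := by
    refine tendsto_integral_filter_of_dominated_convergence (bd m C)
      (Eventually.of_forall fun n => (fN_measurable m n).aestronglyMeasurable) ?_
      (bd_integrable m C) (ae_of_all _ (fN_tendsto m))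
    filter_upwards [eventually_ge_atTop 3, eventually_ge_atTop (2 * (m + 2))] with n h1 h2
    exact ae_of_all _ (hC n h1 h2)
  refine this.congr' ?_
  filter_upwards [fN_integrable_eventually m] with n hn
  rw [integral_prod _ hn]

lemma beta_four (m : ℕ) (y : ℝ) :
    ∫ x in (0:ℝ)..y, x ^ 4 * (y - x) ^ m =
      24 * y ^ (m + 5) / ((m + 1) * (m + 2) * (m + 3) * (m + 4) * (m + 5)) := by
  have h := intervalIntegral.integral_comp_sub_left (a := 0) (b := y)
    (fun x : ℝ => (y - x) ^ 4 * x ^ m) y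
  simp only [sub_sub_cancel, sub_self, sub_zero] at h
  rw [h]
  have e : ∀ x : ℝ, (y - x) ^ 4 * x ^ m = y ^ 4 * x ^ m - 4 * y ^ 3 * x ^ (m + 1)
      + 6 * y ^ 2 * x ^ (m + 2) - 4 * y * x ^ (m + 3) + x ^ (m + 4) := by
    intro x; ring
  simp_rw [e]
  have hi : ∀ (c : ℝ) (j : ℕ), IntervalIntegrable (fun x : ℝ => c * x ^ j) volume 0 y :=
    fun c j => (by fun_prop : Continuous (fun x : ℝ => c * x ^ j)).intervalIntegrable _ _
  have hi' : ∀ (j : ℕ), IntervalIntegrable (fun x : ℝ => x ^ j) volume 0 y :=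
    fun j => (by fun_prop : Continuous (fun x : ℝ => x ^ j)).intervalIntegrable _ _
  rw [intervalIntegral.integral_add ((((hi _ _).sub (hi _ _)).add (hi _ _)).sub (hi _ _)) (hi' _),
    intervalIntegral.integral_sub (((hi _ _).sub (hi _ _)).add (hi _ _)) (hi _ _),
    intervalIntegral.integral_add ((hi _ _).sub (hi _ _)) (hi _ _),
    intervalIntegral.integral_sub (hi _ _) (hi _ _)]
  simp only [intervalIntegral.integral_const_mul, integral_pow]
  push_cast
  have : (0:ℝ) ≤ m := by positivity
  field_simp
  ring

lemma gL_integral (m : ℕ) : ∫ p, gL m p ∂(volume.prod volume) =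
    Real.sqrt (2 * Real.pi) * 24 * m.factorial / ((m + 4) * (m + 5)) := by
  rw [integral_prod_symm _ (gL_integrable m)]
  have inner : ∀ y : ℝ, ∫ x, gL m (x, y) = (Ioi (0:ℝ)).indicator (fun y =>
      (Real.sqrt (2 * Real.pi) * 24 / ((m + 1) * (m + 2) * (m + 3) * (m + 4) * (m + 5))) *
        (Real.exp (-y) * y ^ (m + 3))) y := by
    intro y
    by_cases hy : 0 < y
    · rw [indicator_of_mem (show y ∈ Ioi (0:ℝ) from hy)]
      have e : (fun x => gL m (x, y)) = (Ioo 0 y).indicator (fun x =>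
          (Real.sqrt (2 * Real.pi) / y ^ 2 * Real.exp (-y)) * (x ^ 4 * (y - x) ^ m)) := by
        funext x
        unfold gL
        dsimp only
        by_cases h : 0 < x ∧ x < y
        · rw [if_pos h, indicator_of_mem (show x ∈ Ioo 0 y from h)]
          ring
        · rw [if_neg h, indicator_of_notMem (show x ∉ Ioo 0 y from h)]
      rw [e, integral_indicator measurableSet_Ioo, ← integral_Ioc_eq_integral_Ioo,
        ← intervalIntegral.integral_of_le hy.le, intervalIntegral.integral_const_mul, beta_four]
      field_simp
      ring
    · rw [indicator_of_notMem (show y ∉ Ioi (0:ℝ) from hy)]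
      have e : (fun x => gL m (x, y)) = fun _ => 0 := by
        funext x
        unfold gL
        dsimp only
        rw [if_neg]
        rintro ⟨h1, h2⟩
        exact hy (h1.trans h2)
      rw [e, integral_zero]
  simp_rw [inner]
  rw [integral_indicator measurableSet_Ioi, integral_const_mul]
  have hg : ∫ y in Ioi (0:ℝ), Real.exp (-y) * y ^ (m + 3) = (m + 3).factorial := by
    rw [← Real.Gamma_nat_eq_factorial, Real.Gamma_eq_integral (by positivity)]
    refine setIntegral_congr_fun measurableSet_Ioi fun y _ => ?_
    have : ((m + 3 : ℕ) : ℝ) + 1 - 1 = ((m + 3 : ℕ) : ℝ) := by ring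
    simp only [this, Real.rpow_natCast]
  rw [hg]
  have hf : ((m + 3).factorial : ℝ) = (m + 3) * (m + 2) * (m + 1) * m.factorial := by
    simp only [Nat.factorial_succ]
    push_cast
    ring
  rw [hf]
  field_simp

lemma rescale (m n : ℕ) (hn : 2 ≤ n) :
    (n : ℝ) ^ 2 / Real.sqrt (Real.log n) *
      (∫ u in Set.Ioo (0 : ℝ) 1, ∫ v in Set.Ioo u 1,
              stdNormalCDF (Real.sqrt 2 *
                  (2 * stdNormalCDFInv u - stdNormalCDFInv v)) *
                (v - u) ^ m * (1 - v) ^ (n - (m + 2)))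
      = ((n : ℝ) ^ (m + 2))⁻¹ * ∫ x, ∫ y, fN m n (x, y) := by
  have n0 : (0:ℝ) < n := by exact_mod_cast (by omega : 0 < n)
  set H : ℝ → ℝ → ℝ := fun u v => (Ioo (0:ℝ) 1).indicator (fun u => (Ioo u 1).indicator (fun v =>
    stdNormalCDF (Real.sqrt 2 * (2 * stdNormalCDFInv u - stdNormalCDFInv v)) *
                (v - u) ^ m * (1 - v) ^ (n - (m + 2))) v) u with hH
  have e1 : (∫ u in Set.Ioo (0 : ℝ) 1, ∫ v in Set.Ioo u 1,
              stdNormalCDF (Real.sqrt 2 *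
                  (2 * stdNormalCDFInv u - stdNormalCDFInv v)) *
                (v - u) ^ m * (1 - v) ^ (n - (m + 2))) = ∫ u, ∫ v, H u v := by
    rw [← integral_indicator measurableSet_Ioo]
    congr 1
    funext u
    by_cases hu : u ∈ Ioo (0:ℝ) 1
    · simp only [hH, indicator_of_mem hu]
      rw [integral_indicator measurableSet_Ioo]
    · simp only [hH, indicator_of_notMem hu]
      simp
  have e2 : ∀ x y, fN m n (x, y) =
      ((n:ℝ) ^ 2 / Real.sqrt (Real.log n) * (n : ℝ) ^ m) * H (x / n) (y / n) := by
    intro x y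
    unfold fN
    simp only [hH]
    by_cases h : 0 < x ∧ x < y ∧ y < n
    · have h1 : x / n ∈ Ioo (0:ℝ) 1 :=
        ⟨div_pos h.1 n0, (div_lt_one n0).2 (h.2.1.trans h.2.2)⟩
      have h2 : y / n ∈ Ioo (x / (n:ℝ)) 1 :=
        ⟨(div_lt_div_iff_of_pos_right n0).2 h.2.1, (div_lt_one n0).2 h.2.2⟩
      rw [if_pos h, indicator_of_mem h1, indicator_of_mem h2]
      have : (y / (n:ℝ) - x / n) ^ m = (y - x) ^ m / (n:ℝ) ^ m := by
        rw [← sub_div, div_pow]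
      rw [this]
      field_simp
    · rw [if_neg h]
      by_cases h1 : x / n ∈ Ioo (0:ℝ) 1
      · rw [indicator_of_mem h1, indicator_of_notMem, mul_zero]
        intro h2
        apply h
        refine ⟨(div_pos_iff_of_pos_right n0).1 h1.1, (div_lt_div_iff_of_pos_right n0).1 h2.1,
          (div_lt_one n0).1 h2.2⟩
      · rw [indicator_of_notMem h1, mul_zero]
  rw [e1]
  simp_rw [e2, integral_const_mul]
  have e3 : ∀ x : ℝ, ∫ y, H (x / n) (y / n) = n * ∫ v, H (x / n) v := by
    intro x
    rw [Measure.integral_comp_div (fun v => H (x / n) v), abs_of_pos n0, smul_eq_mul]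
  simp_rw [e3, integral_const_mul]
  rw [Measure.integral_comp_div (fun u => ∫ v, H u v), abs_of_pos n0, smul_eq_mul]
  field_simp
  ring

/-- Fixed-order-index one-row relaxation asymptotics: for fixed `k ≥ 2`, with
`P_{n,k} = (n!/((k−2)!(n−k)!)) ∫₀¹∫_u^1 Φ(√2(2Φ⁻¹(u) − Φ⁻¹(v)))
(v−u)^{k−2}(1−v)^{n−k} dv du`, one has
`(n²/√(log n)) · P_{n,k} → 24√(2π)/((k+2)(k+3))`. -/
theorem one_row_fixed_order_index_asymptotics (k : ℕ) (hk : 2 ≤ k) :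
    Tendsto (fun n : ℕ =>
        ((n : ℝ) ^ 2 / Real.sqrt (Real.log n)) *
          (((n.factorial : ℝ) /
              ((k - 2).factorial * (n - k).factorial)) *
            ∫ u in Set.Ioo (0 : ℝ) 1, ∫ v in Set.Ioo u 1,
              stdNormalCDF (Real.sqrt 2 *
                  (2 * stdNormalCDFInv u - stdNormalCDFInv v)) *
                (v - u) ^ (k - 2) * (1 - v) ^ (n - k)))
      atTop
      (nhds (24 * Real.sqrt (2 * Real.pi) /
        (((k : ℝ) + 2) * ((k : ℝ) + 3)))) := by
  obtain ⟨m, rfl⟩ : ∃ m, k = m + 2 := ⟨k - 2, by omega⟩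
  have h1 := fN_integral_tendsto m
  rw [gL_integral] at h1
  have h2 : Tendsto (fun n : ℕ => ((n.descFactorial (m + 2) : ℕ) : ℝ) / (n : ℝ) ^ (m + 2))
      atTop (𝓝 1) := by
    refine (Asymptotics.isEquivalent_iff_tendsto_one ?_).1 (isEquivalent_descFactorial (m + 2))
    filter_upwards [eventually_gt_atTop 0] with n hn
    have : (0:ℝ) < n := by exact_mod_cast hn
    positivity
  have h3 := (h2.mul h1).div_const (m.factorial : ℝ)
  have hm : (0:ℝ) < m.factorial := by exact_mod_cast m.factorial_pos
  have e : (1 * (Real.sqrt (2 * Real.pi) * 24 * m.factorial / (((m:ℝ) + 4) * (m + 5)))) / m.factorial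
      = 24 * Real.sqrt (2 * Real.pi) / ((((m + 2 : ℕ) : ℝ) + 2) * (((m + 2 : ℕ) : ℝ) + 3)) := by
    push_cast
    field_simp
    ring
  rw [e] at h3
  refine h3.congr' ?_
  filter_upwards [eventually_ge_atTop (m + 2)] with n hn
  have hr := rescale m n (by omega)
  have hsub : m + 2 - 2 = m := by omega
  rw [hsub]
  have hd : (n.factorial : ℝ) = ((n - (m + 2)).factorial : ℝ) * (n.descFactorial (m + 2) : ℝ) := by
    exact_mod_cast (Nat.factorial_mul_descFactorial hn).symm
  have hf : (0:ℝ) < (n - (m + 2)).factorial := by exact_mod_cast Nat.factorial_pos _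
  have n0 : (0:ℝ) < n := by exact_mod_cast (by omega : 0 < n)
  rw [hd]
  generalize (∫ u in Set.Ioo (0 : ℝ) 1, ∫ v in Set.Ioo u 1,
              stdNormalCDF (Real.sqrt 2 *
                  (2 * stdNormalCDFInv u - stdNormalCDFInv v)) *
                (v - u) ^ m * (1 - v) ^ (n - (m + 2))) = I at *
  have hI : ∀ a b c d : ℝ, a * (b * c) = b * (a * c) := fun a b c d => by ring
  rw [hI _ _ _ 0, hr]
  field_simp
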